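/- Let G be a finite connected simple graph, u a vertex of G of degree d ≥ 2 with incident edges e₁, …, e_d, and let G_cut be the graph obtained from G by introducing a new vertex ū and re-joining e₂, …, e_d to ū instead of u (so that e₁ is the only edge of G_cut incident to u); assume G_cut is connected and identify E(G_cut) ≅ E(G). Then Λ₁(G_cut) ≤ Λ₁(G) (as elements of [0, ∞]). -/

import Mathlib

open Finset Filter Topology
open scoped Classical ENNReal

noncomputable section

variable {V : Type*} [Fintype V]

/-- The set of neighbors of `u` as a `Finset`. -/
def nbr (G : SimpleGraph V) (u : V) : Finset V :=
  Finset.univ.filter (fun v => G.Adj u v)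

/-- The vertex-weight `m₀(u) = ∑_{v ∼ u} l(uv)` induced by the edge-length function `l`. -/
def m0 (G : SimpleGraph V) (l : V → V → ℝ) (u : V) : ℝ :=
  ∑ v ∈ nbr G u, l u v

/-- The Fujiwara Laplacian `(Δ_l φ)(u) = ∑_{v ∼ u} (m₁(uv)/m₀(u)) (φ(u) − φ(v))`,
where `m₁(uv) = 1/l(uv)`. -/
def lap (G : SimpleGraph V) (l : V → V → ℝ) (φ : V → ℝ) (u : V) : ℝ :=
  ∑ v ∈ nbr G u, ((1 / l u v) / m0 G l u) * (φ u - φ v)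

/-- `l` is an edge-length function: symmetric and positive on adjacent pairs. -/
def IsLength (G : SimpleGraph V) (l : V → V → ℝ) : Prop :=
  (∀ u v, l u v = l v u) ∧ ∀ u v, G.Adj u v → 0 < l u v

/-- The Dirichlet energy `∑_{uv ∈ E} m₁(uv) (φ(u) − φ(v))²`
(each edge counted once, via half the sum over ordered adjacent pairs). -/
def energy (G : SimpleGraph V) (l : V → V → ℝ) (φ : V → ℝ) : ℝ :=
  (1/2) * ∑ u, ∑ v ∈ nbr G u, (1 / l u v) * (φ u - φ v) ^ 2

/-- The squared norm `∑_{u ∈ V} m₀(u) φ(u)²`. -/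
def mass (G : SimpleGraph V) (l : V → V → ℝ) (φ : V → ℝ) : ℝ :=
  ∑ u, m0 G l u * φ u ^ 2

/-- The first nonzero eigenvalue of the Fujiwara Laplacian, via its variational
characterization as the infimum of the Rayleigh quotient over nonzero functions
orthogonal to the constants. -/
def lambda1 (G : SimpleGraph V) (l : V → V → ℝ) : ℝ :=
  sInf { r | ∃ φ : V → ℝ, φ ≠ 0 ∧ (∑ u, m0 G l u * φ u) = 0 ∧
    r = energy G l φ / mass G l φ }

/-- The largest eigenvalue of the Fujiwara Laplacian, via its variational
characterization as the supremum of the Rayleigh quotient. -/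
def lambdaMax (G : SimpleGraph V) (l : V → V → ℝ) : ℝ :=
  sSup { r | ∃ φ : V → ℝ, φ ≠ 0 ∧ r = energy G l φ / mass G l φ }

/-- `Λ₁(G)`: the supremum, in `[0, ∞]`, of `λ₁(G, l)` over all edge-length functions `l`
normalized by `∑_{u ∈ V} m₀(u) = 1`. -/
def Lambda1 (G : SimpleGraph V) : ℝ≥0∞ :=
  ⨆ (l : V → V → ℝ) (_ : IsLength G l ∧ (∑ u, m0 G l u) = 1),
    ENNReal.ofReal (lambda1 G l)

/-- `μ` is the nondecreasing sequence of eigenvalues (with multiplicity) of the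
Fujiwara Laplacian `Δ_l`: it is monotone and admits a corresponding family of
eigenfunctions that is orthonormal for the inner product `⟨φ, ψ⟩ = ∑ m₀(u) φ(u) ψ(u)`. -/
def IsLapEigSeq (G : SimpleGraph V) (l : V → V → ℝ)
    (μ : Fin (Fintype.card V) → ℝ) : Prop :=
  Monotone μ ∧ ∃ φ : Fin (Fintype.card V) → V → ℝ,
    (∀ i u, lap G l (φ i) u = μ i * φ i u) ∧
    (∀ i j, (∑ u, m0 G l u * φ i u * φ j u) = if i = j then 1 else 0)


/-- The graph `G_cut` obtained from `G` by cutting at the vertex `u`: a new clone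
vertex `ū` (here `none`) is introduced, and every edge of `G` at `u` other than the
edge `u w₁` is re-joined to `ū` instead of `u`. The old vertices are embedded via
`some`, so `u w₁` is the only edge of `G_cut` incident to `u`. -/
def cutAt (G : SimpleGraph V) (u w₁ : V) : SimpleGraph (Option V) :=
  SimpleGraph.fromRel (fun a b =>
    (∃ x y, a = some x ∧ b = some y ∧ G.Adj x y ∧ (x = u → y = w₁) ∧ (y = u → x = w₁)) ∨
    (∃ y, a = none ∧ b = some y ∧ G.Adj u y ∧ y ≠ w₁))

/-- The edge-length function on `G_cut` corresponding to `l` under the natural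
identification `E(G_cut) ≅ E(G)`: an edge between old vertices keeps its length, and
an edge from the clone vertex `ū` to `y` has the length `l(u, y)` of the original
edge `u y`. -/
def cutLen (l : V → V → ℝ) (u : V) : Option V → Option V → ℝ
  | some x, some y => l x y
  | some x, none => l u x
  | none, some y => l u y
  | none, none => 1

/-- The projection `G_cut → G` gluing the clone vertex back to `u`. -/
def glue (u : V) (a : Option V) : V := a.getD u

/-- The tail, in `G_cut`, of the dart of `G_cut` corresponding to the dart `x → y` of `G`. -/
def cutTail (u w₁ x y : V) : Option V := if x = u ∧ y ≠ w₁ then none else some x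

lemma glue_cutTail {V : Type*} (u w₁ x y : V) : glue u (cutTail u w₁ x y) = x := by
  unfold glue cutTail
  split_ifs with h
  · exact h.1.symm
  · rfl

lemma cutAt_adj_cutTail {V : Type*} {G : SimpleGraph V} {u w₁ x y : V} (hadj : G.Adj u w₁)
    (h : G.Adj x y) : (cutAt G u w₁).Adj (cutTail u w₁ x y) (cutTail u w₁ y x) := by
  have hne := h.ne
  have hsymm := h.symm
  unfold cutTail cutAt
  rw [SimpleGraph.fromRel_adj]
  by_cases hx : x = u <;> by_cases hy : y = u <;> by_cases hxw : x = w₁ <;>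
    by_cases hyw : y = w₁ <;> simp_all

lemma adj_glue_of_cutAt_adj {V : Type*} {G : SimpleGraph V} {u w₁ : V} {a b : Option V}
    (h : (cutAt G u w₁).Adj a b) : G.Adj (glue u a) (glue u b) := by
  unfold cutAt at h
  rw [SimpleGraph.fromRel_adj] at h
  obtain ⟨-, (⟨x, y, rfl, rfl, h, -⟩ | ⟨y, rfl, rfl, h, -⟩) |
    (⟨x, y, rfl, rfl, h, -⟩ | ⟨y, rfl, rfl, h, -⟩)⟩ := h
  exacts [h, h, h.symm, h.symm]

lemma cutTail_glue_of_cutAt_adj {V : Type*} {G : SimpleGraph V} {u w₁ : V} {a b : Option V}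
    (h : (cutAt G u w₁).Adj a b) : cutTail u w₁ (glue u a) (glue u b) = a := by
  unfold cutAt at h
  rw [SimpleGraph.fromRel_adj] at h
  obtain ⟨-, (⟨x, y, rfl, rfl, h, h1, h2⟩ | ⟨y, rfl, rfl, h, h1⟩) |
    (⟨x, y, rfl, rfl, h, h1, h2⟩ | ⟨y, rfl, rfl, h, h1⟩)⟩ := h
  · exact if_neg fun hc => hc.2 (h1 hc.1)
  · simpa [cutTail, glue] using h1
  · exact if_neg fun hc => hc.2 (h2 hc.1)
  · simp [cutTail, glue, h.ne']

/-- Sums over the darts of `G_cut` are sums over the darts of `G`. -/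
lemma sum_nbr_cutAt {G : SimpleGraph V} {u w₁ : V} (hadj : G.Adj u w₁)
    (F : Option V → Option V → ℝ) :
    ∑ a, ∑ b ∈ nbr (cutAt G u w₁) a, F a b =
      ∑ x, ∑ y ∈ nbr G x, F (cutTail u w₁ x y) (cutTail u w₁ y x) := by
  rw [Finset.sum_sigma', Finset.sum_sigma']
  refine Finset.sum_bij' (fun p _ => ⟨glue u p.1, glue u p.2⟩)
    (fun p _ => ⟨cutTail u w₁ p.1 p.2, cutTail u w₁ p.2 p.1⟩) ?_ ?_ ?_ ?_ ?_
  · rintro ⟨a, b⟩ h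
    simp only [nbr, mem_sigma, mem_univ, mem_filter, true_and] at h ⊢
    exact adj_glue_of_cutAt_adj h
  · rintro ⟨x, y⟩ h
    simp only [nbr, mem_sigma, mem_univ, mem_filter, true_and] at h ⊢
    exact cutAt_adj_cutTail hadj h
  · rintro ⟨a, b⟩ h
    simp only [nbr, mem_sigma, mem_univ, mem_filter, true_and] at h
    simp only [cutTail_glue_of_cutAt_adj h, cutTail_glue_of_cutAt_adj h.symm]
  · rintro ⟨x, y⟩ -
    simp only [glue_cutTail]
  · rintro ⟨a, b⟩ h
    simp only [nbr, mem_sigma, mem_univ, mem_filter, true_and] at h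
    simp only [cutTail_glue_of_cutAt_adj h, cutTail_glue_of_cutAt_adj h.symm]

/-- The edge-length function on `G` corresponding to `l` on `G_cut`. -/
def glueLen (u w₁ : V) (l : Option V → Option V → ℝ) (x y : V) : ℝ :=
  l (cutTail u w₁ x y) (cutTail u w₁ y x)

lemma IsLength.glueLen {V : Type*} {G : SimpleGraph V} {u w₁ : V} (hadj : G.Adj u w₁)
    {l : Option V → Option V → ℝ} (hl : IsLength (cutAt G u w₁) l) :
    IsLength G (glueLen u w₁ l) :=
  ⟨fun _ _ => hl.1 _ _, fun _ _ h => hl.2 _ _ (cutAt_adj_cutTail hadj h)⟩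

/-- Integrating a function pulled back from `G` against the vertex-weight of `G_cut`. -/
lemma sum_m0_cutAt {G : SimpleGraph V} {u w₁ : V} (hadj : G.Adj u w₁)
    (l : Option V → Option V → ℝ) (f : V → ℝ) :
    ∑ a, m0 (cutAt G u w₁) l a * f (glue u a) = ∑ x, m0 G (glueLen u w₁ l) x * f x := by
  simp only [m0, Finset.sum_mul]
  rw [sum_nbr_cutAt hadj (fun a b => l a b * f (glue u a))]
  simp only [glue_cutTail, glueLen]

lemma energy_cutAt {G : SimpleGraph V} {u w₁ : V} (hadj : G.Adj u w₁)
    (l : Option V → Option V → ℝ) (φ : V → ℝ) :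
    energy (cutAt G u w₁) l (fun a => φ (glue u a)) = energy G (glueLen u w₁ l) φ := by
  unfold energy
  rw [sum_nbr_cutAt hadj (fun a b => (1 / l a b) * (φ (glue u a) - φ (glue u b)) ^ 2)]
  simp only [glue_cutTail, glueLen]

lemma m0_nonneg {G : SimpleGraph V} {l : V → V → ℝ} (hl : IsLength G l) (x : V) :
    0 ≤ m0 G l x :=
  Finset.sum_nonneg fun _ hy => (hl.2 _ _ (mem_filter.1 hy).2).le

lemma m0_pos {G : SimpleGraph V} {l : V → V → ℝ} (hl : IsLength G l) {x y : V}
    (h : G.Adj x y) : 0 < m0 G l x :=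
  Finset.sum_pos (fun _ hy => hl.2 _ _ (mem_filter.1 hy).2)
    ⟨y, mem_filter.2 ⟨mem_univ _, h⟩⟩

lemma rayleigh_nonneg {G : SimpleGraph V} {l : V → V → ℝ} (hl : IsLength G l) (φ : V → ℝ) :
    0 ≤ energy G l φ / mass G l φ := by
  refine div_nonneg (mul_nonneg (by norm_num) ?_) ?_
  · exact Finset.sum_nonneg fun x _ => Finset.sum_nonneg fun y hy =>
      mul_nonneg (one_div_nonneg.2 (hl.2 _ _ (mem_filter.1 hy).2).le) (sq_nonneg _)
  · exact Finset.sum_nonneg fun x _ => mul_nonneg (m0_nonneg hl x) (sq_nonneg _)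

lemma exists_ne_zero_sum_m0_mul_eq_zero {G : SimpleGraph V} {l : V → V → ℝ}
    (hl : IsLength G l) {x y : V} (h : G.Adj x y) :
    ∃ φ : V → ℝ, φ ≠ 0 ∧ ∑ z, m0 G l z * φ z = 0 := by
  refine ⟨Pi.single x (m0 G l y) - Pi.single y (m0 G l x), fun h0 => ?_, ?_⟩
  · have hx := congrFun h0 x
    simp [h.ne] at hx
    exact (m0_pos hl h.symm).ne' hx
  · simp [mul_sub, Finset.sum_sub_distrib, Pi.single_apply, mul_comm]

lemma lambda1_cutAt_le {G : SimpleGraph V} {u w₁ : V} (hadj : G.Adj u w₁)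
    {l : Option V → Option V → ℝ} (hl : IsLength (cutAt G u w₁) l) :
    lambda1 (cutAt G u w₁) l ≤ lambda1 G (glueLen u w₁ l) := by
  refine csInf_le_csInf ⟨0, ?_⟩ ?_ ?_
  · rintro _ ⟨φ, -, -, rfl⟩
    exact rayleigh_nonneg hl φ
  · obtain ⟨φ, h0, h1⟩ := exists_ne_zero_sum_m0_mul_eq_zero (hl.glueLen hadj) hadj
    exact ⟨_, φ, h0, h1, rfl⟩
  · rintro _ ⟨φ, h0, h1, rfl⟩
    refine ⟨fun a => φ (glue u a), fun h => h0 ?_, ?_, ?_⟩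
    · exact funext fun x => congrFun h (some x)
    · exact (sum_m0_cutAt hadj l φ).trans h1
    · rw [energy_cutAt hadj]
      exact congrArg _ (sum_m0_cutAt hadj l fun x => φ x ^ 2).symm

/-- Let `u` be a vertex of the finite connected simple graph `G` of degree `d ≥ 2`, let
`w₁` be one of its neighbors, and let `G_cut` be obtained by cutting `G` at `u` so that
`u w₁` is the only edge at `u` (the other edges at `u` being re-joined to a clone `ū`).
If `G_cut` is connected, then `Λ₁(G_cut) ≤ Λ₁(G)` (as elements of `[0, ∞]`). -/
theorem Lambda1_cut_le {V : Type*} [Fintype V] (G : SimpleGraph V) (hconn : G.Connected)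
    (u w₁ : V) (hadj : G.Adj u w₁)
    (hdeg : 2 ≤ (nbr G u).card) (hcut : (cutAt G u w₁).Connected) :
    Lambda1 (cutAt G u w₁) ≤ Lambda1 G := by
  refine iSup₂_le fun l hl => ?_
  refine le_iSup₂_of_le (glueLen u w₁ l) ⟨hl.1.glueLen hadj, ?_⟩
    (ENNReal.ofReal_le_ofReal (lambda1_cutAt_le hadj hl.1))
  have h := sum_m0_cutAt hadj l fun _ => 1
  simp only [mul_one] at h
  exact h.symm.trans hl.2

end
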